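/- Let p be an odd prime, let G be a finite p-group generated by two elements a and b such that the derived subgroup γ_2(G) has exponent dividing p, and let r ∈ ℕ. Let K(a,[a,b]) be the normal closure in G of the set of all values of formal commutators in the letters a and c = [a,b] of total weight at least p^r having weight at least 2 in the letter c. Then [a^{p^r}, b] ≡ [a, b, a, a, …, a] (with p^r − 1 copies of a after b) modulo K(a,[a,b]). -/

import Mathlib

/-- The commutator `[u,v] = u⁻¹ v⁻¹ u v`. -/
def cmt {G : Type*} [Group G] (u v : G) : G := u⁻¹ * v⁻¹ * u * v

/-- The left-normed iterated commutator `[g, x, x, …, x]` with `n` copies of `x`. -/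
def iteratedCmt {G : Type*} [Group G] (g x : G) : ℕ → G
  | 0 => g
  | (n + 1) => cmt (iteratedCmt g x n) x

/-- Formal commutators in two letters. -/
inductive FormalCommutator : Type
  | fst : FormalCommutator
  | snd : FormalCommutator
  | comm : FormalCommutator → FormalCommutator → FormalCommutator

namespace FormalCommutator

/-- The weight of a formal commutator in the first letter. -/
def weightFst : FormalCommutator → ℕ
  | fst => 1
  | snd => 0
  | comm c d => weightFst c + weightFst d

/-- The weight of a formal commutator in the second letter. -/
def weightSnd : FormalCommutator → ℕ
  | fst => 0
  | snd => 1
  | comm c d => weightSnd c + weightSnd d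

/-- The value of a formal commutator when the two letters are substituted by `u` and `v`. -/
def eval {G : Type*} [Group G] (u v : G) : FormalCommutator → G
  | fst => u
  | snd => v
  | comm c d => cmt (eval u v c) (eval u v d)

end FormalCommutator

section CommutatorIdentities

variable {G : Type*} [Group G]

theorem cmt_mem_commutator (x y : G) : cmt x y ∈ commutator G := by
  have h := Subgroup.commutator_mem_commutator (Subgroup.mem_top x⁻¹) (Subgroup.mem_top y⁻¹)
  rw [commutatorElement_def, inv_inv, inv_inv] at h
  exact h

theorem conj_eq_mul_cmt (x y : G) : y⁻¹ * x * y = x * cmt x y := by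
  simp only [cmt]; group

theorem cmt_mul_mul (x u y v : G) :
    (cmt x y)⁻¹ * cmt (x * u) (y * v) =
      ((cmt x y)⁻¹ * cmt (x * u) v * cmt x y) * cmt (cmt x y) (u * v) *
        (v⁻¹ * cmt u y * v) := by
  simp only [cmt]; group

theorem iteratedCmt_cmt (x a : G) (n : ℕ) :
    iteratedCmt (cmt x a) a n = iteratedCmt x a (n + 1) := by
  induction n with
  | zero => rfl
  | succ n ih => rw [iteratedCmt, ih, ← iteratedCmt]

/-- If two generated subgroups normalize `N`, commutators of their elements lie in `N` as soon
as commutators of the generators do. -/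
theorem cmt_mem_of_closure {N : Subgroup G} {S T : Set G}
    (hS : Subgroup.closure S ≤ Subgroup.normalizer (N : Set G))
    (hT : Subgroup.closure T ≤ Subgroup.normalizer (N : Set G))
    (h : ∀ s ∈ S, ∀ t ∈ T, cmt s t ∈ N) {x y : G}
    (hx : x ∈ Subgroup.closure S) (hy : y ∈ Subgroup.closure T) : cmt x y ∈ N := by
  have conj {g n : G} (hg : g ∈ Subgroup.normalizer (N : Set G)) (hn : n ∈ N) :
      g⁻¹ * n * g ∈ N := by
    simpa using (Subgroup.mem_normalizer_iff.1 (inv_mem hg) n).1 hn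
  have key : ∀ s ∈ S, cmt s y ∈ N := by
    intro s hs
    induction hy using Subgroup.closure_induction with
    | mem t ht => exact h s hs t ht
    | one => simp [cmt]
    | mul u v hu hv ihu ihv =>
      have : cmt s (u * v) = cmt s v * (v⁻¹ * cmt s u * v) := by simp only [cmt]; group
      rw [this]
      exact mul_mem ihv (conj (hT hv) ihu)
    | inv u hu ihu =>
      have : cmt s u⁻¹ = u⁻¹⁻¹ * (cmt s u)⁻¹ * u⁻¹ := by simp only [cmt]; group
      rw [this]
      exact conj (inv_mem (hT hu)) (inv_mem ihu)
  induction hx using Subgroup.closure_induction with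
  | mem s hs => exact key s hs
  | one => simp [cmt]
  | mul u v hu hv ihu ihv =>
    have : cmt (u * v) y = (v⁻¹ * cmt u y * v) * cmt v y := by simp only [cmt]; group
    rw [this]
    exact mul_mem (conj (hS hv) ihu) ihv
  | inv u hu ihu =>
    have : cmt u⁻¹ y = u⁻¹⁻¹ * (cmt u y)⁻¹ * u⁻¹ := by simp only [cmt]; group
    rw [this]
    exact conj (inv_mem (hS hu)) (inv_mem ihu)

end CommutatorIdentities

section PolynomialSequences

variable {G : Type*} [Group G]

/-- A decreasing family of subgroups, doubly indexed, in which commutators add degrees. -/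
structure BiFiltration (G : Type*) [Group G] where
  /-- The subgroups of the family. -/
  sub : ℕ → ℕ → Subgroup G
  anti : ∀ {i i' j j' : ℕ}, i ≤ i' → j ≤ j' → sub i' j' ≤ sub i j
  cmt_mem : ∀ {i j k l : ℕ} {x y : G}, x ∈ sub i j → y ∈ sub k l →
    cmt x y ∈ sub (i + k) (j + l)

/-- The discrete derivative `m ↦ s(m)⁻¹ s(m+1)` of a sequence in a group. -/
def discreteDeriv (s : ℕ → G) : ℕ → G := fun m => (s m)⁻¹ * s (m + 1)

theorem discreteDeriv_mul (s t : ℕ → G) :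
    discreteDeriv (s * t) = (t⁻¹ * discreteDeriv s * t) * discreteDeriv t := by
  funext m
  simp only [discreteDeriv, Pi.mul_apply, Pi.inv_apply]; group

theorem discreteDeriv_inv (s : ℕ → G) :
    discreteDeriv s⁻¹ = s * (discreteDeriv s)⁻¹ * s⁻¹ := by
  funext m
  simp only [discreteDeriv, Pi.mul_apply, Pi.inv_apply]; group

theorem discreteDeriv_cmt (s t : ℕ → G) :
    discreteDeriv (cmt s t) =
      (cmt s t)⁻¹ * cmt (s * discreteDeriv s) (t * discreteDeriv t) := by
  funext m
  simp only [discreteDeriv, Pi.mul_apply, Pi.inv_apply, cmt]; group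

theorem discreteDeriv_one : discreteDeriv (1 : ℕ → G) = 1 := by
  funext m
  simp [discreteDeriv]

theorem discreteDeriv_pow_choose_succ (h : G) (k : ℕ) :
    discreteDeriv (fun m => h ^ m.choose (k + 1)) = fun m => h ^ m.choose k := by
  funext m
  simp only [discreteDeriv, Nat.choose_succ_succ', Nat.add_comm (m.choose k), pow_add,
    inv_mul_cancel_left]

theorem iterate_discreteDeriv_zero (K : ℕ) (s : ℕ → G) (hs : ∀ m < K, s m = 1) :
    discreteDeriv^[K] s 0 = s K := by
  induction K generalizing s with
  | zero => rfl
  | succ K ih =>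
    rw [Function.iterate_succ_apply, ih]
    · simp [discreteDeriv, hs K (Nat.lt_succ_self K)]
    · intro m hm
      simp [discreteDeriv, hs m (by lia), hs (m + 1) (by lia)]

namespace BiFiltration

variable (H : BiFiltration G)

/-- A sequence is polynomial of degree `(i, j)` if its `k`-th discrete derivative takes values
in `H.sub (i + k) j` for every `k`. -/
def IsPoly (i j : ℕ) (s : ℕ → G) : Prop :=
  ∀ k m, discreteDeriv^[k] s m ∈ H.sub (i + k) j

/-- The bifiltration of the group of sequences generated by the polynomial sequences. -/
inductive PolyGen : ℕ → ℕ → (ℕ → G) → Prop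
  | base {i j : ℕ} {s : ℕ → G} : H.IsPoly i j s → PolyGen i j s
  | mul {i j : ℕ} {s t : ℕ → G} : PolyGen i j s → PolyGen i j t → PolyGen i j (s * t)
  | inv {i j : ℕ} {s : ℕ → G} : PolyGen i j s → PolyGen i j s⁻¹
  | cmt {i j k l : ℕ} {s t : ℕ → G} : PolyGen i j s → PolyGen k l t →
      PolyGen (i + k) (j + l) (_root_.cmt s t)
  | mono {i i' j j' : ℕ} {s : ℕ → G} : i ≤ i' → j ≤ j' → PolyGen i' j' s → PolyGen i j s

variable {H}

theorem IsPoly.discreteDeriv {i j : ℕ} {s : ℕ → G} (hs : H.IsPoly i j s) :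
    H.IsPoly (i + 1) j (discreteDeriv s) := by
  intro k m
  have := hs (k + 1) m
  rwa [Function.iterate_succ_apply, show i + (k + 1) = i + 1 + k by lia] at this

theorem IsPoly.of_discreteDeriv {i j : ℕ} {s : ℕ → G} (h : ∀ m, s m ∈ H.sub i j)
    (hs : H.IsPoly (i + 1) j (_root_.discreteDeriv s)) : H.IsPoly i j s := by
  rintro (_ | k) m
  · exact h m
  · have := hs k m
    rwa [← Function.iterate_succ_apply, show i + 1 + k = i + (k + 1) by lia] at this

theorem PolyGen.conj {i j : ℕ} {s t : ℕ → G} (hs : H.PolyGen i j s) (ht : H.PolyGen 0 0 t) :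
    H.PolyGen i j (t⁻¹ * s * t) := by
  rw [conj_eq_mul_cmt]
  exact hs.mul (hs.cmt ht)

theorem PolyGen.discreteDeriv {i j : ℕ} {s : ℕ → G} (hs : H.PolyGen i j s) :
    H.PolyGen (i + 1) j (discreteDeriv s) := by
  induction hs with
  | base hs => exact .base hs.discreteDeriv
  | mul hs ht ihs iht =>
    rw [discreteDeriv_mul]
    exact (ihs.conj (ht.mono (Nat.zero_le _) (Nat.zero_le _))).mul iht
  | inv hs ihs =>
    rw [discreteDeriv_inv]
    simpa using ihs.inv.conj (hs.inv.mono (Nat.zero_le _) (Nat.zero_le _))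
  | @cmt i j k l s t hs ht ihs iht =>
    have hu := ihs.mono (Nat.le_succ i) le_rfl
    rw [discreteDeriv_cmt, cmt_mul_mul]
    refine .mul (.mul (.conj ?_ ?_) ?_) (.conj ?_ ?_)
    · exact (hs.mul hu).cmt iht
    · exact (hs.cmt ht).mono (Nat.zero_le _) (Nat.zero_le _)
    · exact (hs.cmt ht).cmt (((ihs.mono (i := 1) (by lia) (Nat.zero_le _))).mul
        (iht.mono (by lia) (Nat.zero_le _)))
    · exact (ihs.cmt ht).mono (by lia) le_rfl
    · exact iht.mono (Nat.zero_le _) (Nat.zero_le _)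
  | mono hi hj _ ih => exact ih.mono (by lia) hj

theorem PolyGen.apply_mem {i j : ℕ} {s : ℕ → G} (hs : H.PolyGen i j s) (m : ℕ) :
    s m ∈ H.sub i j := by
  induction hs with
  | base hs => exact hs 0 m
  | mul _ _ ihs iht => exact mul_mem ihs iht
  | inv _ ihs => exact inv_mem ihs
  | cmt _ _ ihs iht => exact H.cmt_mem ihs iht
  | mono hi hj _ ih => exact H.anti hi hj ih

theorem PolyGen.isPoly {i j : ℕ} {s : ℕ → G} (hs : H.PolyGen i j s) : H.IsPoly i j s := by
  intro k
  suffices H.PolyGen (i + k) j (_root_.discreteDeriv^[k] s) from this.apply_mem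
  induction k with
  | zero => exact hs
  | succ k ih =>
    rw [Function.iterate_succ_apply']
    exact ih.discreteDeriv

variable (H)

/-- The polynomial sequences of degree `(i, j)` form a group. -/
def polySeq (i j : ℕ) : Subgroup (ℕ → G) where
  carrier := {s | H.IsPoly i j s}
  one_mem' := by
    intro k m
    rw [Function.iterate_fixed discreteDeriv_one]
    exact one_mem _
  mul_mem' hs ht := ((PolyGen.base hs).mul (.base ht)).isPoly
  inv_mem' hs := (PolyGen.base hs).inv.isPoly

variable {H}

theorem cmt_mem_polySeq {i j k l : ℕ} {s t : ℕ → G} (hs : s ∈ H.polySeq i j)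
    (ht : t ∈ H.polySeq k l) : cmt s t ∈ H.polySeq (i + k) (j + l) :=
  ((PolyGen.base hs).cmt (.base ht)).isPoly

theorem polySeq_anti {i i' j j' : ℕ} (hi : i ≤ i') (hj : j ≤ j') :
    H.polySeq i' j' ≤ H.polySeq i j :=
  fun _ hs k m => H.anti (by lia) hj (hs k m)

theorem conj_mem_polySeq {i j : ℕ} {s t : ℕ → G} (hs : s ∈ H.polySeq i j)
    (ht : t ∈ H.polySeq 0 0) : t⁻¹ * s * t ∈ H.polySeq i j :=
  ((PolyGen.base hs).conj (.base ht)).isPoly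

theorem discreteDeriv_mem_polySeq {i j : ℕ} {s : ℕ → G} (hs : s ∈ H.polySeq i j) :
    discreteDeriv s ∈ H.polySeq (i + 1) j :=
  IsPoly.discreteDeriv hs

theorem mem_polySeq_of_discreteDeriv {i j : ℕ} {s : ℕ → G} (h : s 0 ∈ H.sub i j)
    (hs : discreteDeriv s ∈ H.polySeq (i + 1) j) : s ∈ H.polySeq i j := by
  refine IsPoly.of_discreteDeriv (fun m => ?_) hs
  induction m with
  | zero => exact h
  | succ m ih =>
    have hm : discreteDeriv s m ∈ H.sub i j := H.anti (by lia) le_rfl (hs 0 m)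
    simpa [discreteDeriv] using mul_mem ih hm

theorem mul_inv_mem_polySeq_of_discreteDeriv {i j : ℕ} {s t : ℕ → G}
    (ht : t ∈ H.polySeq 0 0) (h0 : s 0 = t 0)
    (hd : discreteDeriv s * (discreteDeriv t)⁻¹ ∈ H.polySeq (i + 1) j) :
    s * t⁻¹ ∈ H.polySeq i j := by
  refine mem_polySeq_of_discreteDeriv (by simp [h0]) ?_
  have := conj_mem_polySeq hd (inv_mem ht)
  rw [discreteDeriv_mul, discreteDeriv_inv]
  convert this using 1
  group

theorem pow_choose_mem_polySeq {i j k : ℕ} {h : G} (hh : h ∈ H.sub (i + k) j) :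
    (fun m : ℕ => h ^ m.choose k) ∈ H.polySeq i j := by
  induction k generalizing i with
  | zero =>
    refine mem_polySeq_of_discreteDeriv (by simpa using hh) ?_
    convert one_mem (H.polySeq (i + 1) j) using 1
    funext m
    simp [discreteDeriv]
  | succ k ih =>
    refine mem_polySeq_of_discreteDeriv (by simp) ?_
    rw [discreteDeriv_pow_choose_succ]
    exact ih (by rwa [show i + 1 + k = i + (k + 1) by lia])

theorem const_mem_polySeq {i j : ℕ} {h : G} (hh : h ∈ H.sub i j) :
    (fun _ => h : ℕ → G) ∈ H.polySeq i j := by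
  simpa using pow_choose_mem_polySeq (k := 0) hh

theorem pow_mem_polySeq {h : G} (hh : h ∈ H.sub 1 0) :
    (fun m => h ^ m : ℕ → G) ∈ H.polySeq 0 0 := by
  simpa using pow_choose_mem_polySeq (k := 1) (i := 0) hh

theorem apply_mem_of_forall_lt {i j K : ℕ} {s : ℕ → G} (hs : s ∈ H.polySeq i j)
    (h : ∀ m < K, s m = 1) : s K ∈ H.sub (i + K) j := by
  rw [← iterate_discreteDeriv_zero K s h]
  exact hs K 0

/-- A polynomial sequence vanishing at `0` sends a prime power `n` to the `n`-th filtration step,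
provided the lower steps have exponent `p`. -/
theorem apply_prime_pow_mem {p r j : ℕ} (hp : p.Prime) {s : ℕ → G} (hs : s ∈ H.polySeq 0 j)
    (h0 : s 0 = 1) (hexp : ∀ k, 0 < k → k < p ^ r → ∀ g ∈ H.sub k j, g ^ p = 1) :
    s (p ^ r) ∈ H.sub (p ^ r) j := by
  have key : ∀ K, 1 ≤ K → K ≤ p ^ r →
      ∃ t ∈ H.polySeq 0 j, (∀ m < K, t m = 1) ∧ t (p ^ r) = s (p ^ r) := by
    intro K hK
    induction K, hK using Nat.le_induction with
    | base =>
      intro _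
      exact ⟨s, hs, fun m hm => by rwa [Nat.lt_one_iff.1 hm], rfl⟩
    | succ K hK ih =>
      intro hKn
      obtain ⟨t, ht, hvan, hval⟩ := ih (by lia)
      have hmem : t K ∈ H.sub (0 + K) j := apply_mem_of_forall_lt ht hvan
      refine ⟨(fun m => t K ^ m.choose K)⁻¹ * t,
        mul_mem (inv_mem (pow_choose_mem_polySeq hmem)) ht, fun m hm => ?_, ?_⟩
      · rcases Nat.lt_succ_iff_lt_or_eq.1 hm with hm | rfl
        · simp [Nat.choose_eq_zero_of_lt hm, hvan m hm]
        · simp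
      · obtain ⟨q, hq⟩ := hp.dvd_choose_pow (n := r) (k := K) (by lia) (by lia)
        rw [zero_add] at hmem
        simp [hq, pow_mul, hexp K (by lia) (by lia) _ hmem, hval]
  obtain ⟨t, ht, hvan, hval⟩ := key (p ^ r) (Nat.one_le_pow _ _ hp.pos) le_rfl
  rw [← hval]
  simpa using apply_mem_of_forall_lt ht hvan

end BiFiltration

/-- The sequence `m ↦ ∏_{k < N} [x, a, …, a] ^ C(m, k + l)`, with `k` copies of `a` in the
`k`-th factor. -/
def taylorProd (a : G) : ℕ → G → ℕ → ℕ → G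
  | 0, _, _ => 1
  | (N + 1), x, l => (fun m => x ^ m.choose l) * taylorProd a N (cmt x a) (l + 1)

theorem taylorProd_apply_of_lt (a : G) (N : ℕ) (x : G) {l m : ℕ} (h : m < l) :
    taylorProd a N x l m = 1 := by
  induction N generalizing x l with
  | zero => rfl
  | succ N ih => simp [taylorProd, Nat.choose_eq_zero_of_lt h, ih _ (Nat.lt_succ_of_lt h)]

theorem taylorProd_apply_prime_pow {p : ℕ} (hp : p.Prime) (r : ℕ)
    (hexp : ∀ g ∈ commutator G, g ^ p = 1) (a : G) (N N' l : ℕ) (x : G)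
    (hx : x ∈ commutator G) (hl : 0 < l) (hN : N + l = p ^ r) (hN' : N < N') :
    taylorProd a N' x l (p ^ r) = iteratedCmt x a N := by
  obtain ⟨N', rfl⟩ : ∃ k, N' = k + 1 := ⟨N' - 1, by lia⟩
  rw [taylorProd, Pi.mul_apply]
  induction N generalizing x l N' with
  | zero =>
    rw [taylorProd_apply_of_lt a N' _ (by lia)]
    rw [zero_add] at hN
    simp [iteratedCmt, hN]
  | succ N ih =>
    obtain ⟨q, hq⟩ := hp.dvd_choose_pow (n := r) (k := l) (by lia) (by lia)
    obtain ⟨k, rfl⟩ : ∃ k, N' = k + 1 := ⟨N' - 1, by lia⟩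
    rw [taylorProd, Pi.mul_apply, ih (l + 1) (cmt x a) (cmt_mem_commutator x a) (by lia) (by lia)
      k (by lia), iteratedCmt_cmt, hq, pow_mul, hexp x hx, one_pow, one_mul]

namespace BiFiltration

variable {H : BiFiltration G} {a : G}

theorem taylorProd_mem_polySeq (ha : a ∈ H.sub 1 0) (N : ℕ) {i j l : ℕ} {x : G}
    (hx : x ∈ H.sub (i + l) j) : taylorProd a N x l ∈ H.polySeq i j := by
  induction N generalizing x l with
  | zero => exact one_mem _
  | succ N ih => exact mul_mem (pow_choose_mem_polySeq hx) (ih (H.cmt_mem hx ha))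

theorem discreteDeriv_mul_congr {i : ℕ} {s t : ℕ → G} (hs : s ∈ H.polySeq i 1)
    (ht : t ∈ H.polySeq i 1) :
    discreteDeriv (s * t) * (discreteDeriv s * discreteDeriv t)⁻¹ ∈ H.polySeq (i + 1) 2 := by
  have h1 := cmt_mem_polySeq (discreteDeriv_mem_polySeq hs) ht
  have h2 := conj_mem_polySeq h1 (polySeq_anti (Nat.zero_le _) (Nat.zero_le _)
    (inv_mem (discreteDeriv_mem_polySeq hs)))
  refine polySeq_anti (by lia) le_rfl ?_ (i' := i + 1 + i)
  convert h2 using 1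
  rw [discreteDeriv_mul]
  simp only [cmt]
  group

theorem discreteDeriv_taylorProd_congr (ha : a ∈ H.sub 1 0) (N : ℕ) {i l : ℕ} {x : G}
    (hx : x ∈ H.sub (i + (l + 1)) 1) :
    discreteDeriv (taylorProd a N x (l + 1)) * (taylorProd a N x l)⁻¹ ∈
      H.polySeq (i + 1) 2 := by
  induction N generalizing x l with
  | zero => simp [taylorProd, discreteDeriv_one]
  | succ N ih =>
    have hxa : cmt x a ∈ H.sub (i + (l + 1 + 1)) 1 := H.cmt_mem hx ha
    have hu : (fun m : ℕ => x ^ m.choose (l + 1)) ∈ H.polySeq i 1 := pow_choose_mem_polySeq hx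
    have h1 := discreteDeriv_mul_congr hu (taylorProd_mem_polySeq ha N hxa)
    rw [discreteDeriv_pow_choose_succ] at h1
    have hu' : (fun m : ℕ => x ^ m.choose l) ∈ H.polySeq 0 0 :=
      pow_choose_mem_polySeq (H.anti (by lia) (Nat.zero_le _) hx)
    have h2 := conj_mem_polySeq (ih hxa) (inv_mem hu')
    convert mul_mem h1 h2 using 1
    simp only [taylorProd]
    group

theorem conj_pow_congr_taylorProd (ha : a ∈ H.sub 1 0) {n : ℕ}
    (hH : ∀ i, n < i → H.sub i 1 ≤ H.sub i 2) (N : ℕ) {i : ℕ} (hN : n < i + N) {x : G}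
    (hx : x ∈ H.sub i 1) :
    (fun m => (a ^ m)⁻¹ * x * a ^ m) * (taylorProd a N x 0)⁻¹ ∈ H.polySeq i 2 := by
  induction N generalizing x i with
  | zero =>
    have h := conj_mem_polySeq (const_mem_polySeq hx) (pow_mem_polySeq ha)
    simp only [taylorProd, inv_one, mul_one]
    exact fun k m => hH _ (by lia) (h k m)
  | succ N ih =>
    have hxa : cmt x a ∈ H.sub (i + 1) 1 := H.cmt_mem hx ha
    refine mul_inv_mem_polySeq_of_discreteDeriv (polySeq_anti (Nat.zero_le _) (Nat.zero_le _)
      (taylorProd_mem_polySeq ha (N + 1) (i := i) (j := 1) hx)) ?_ ?_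
    · simp [taylorProd, taylorProd_apply_of_lt]
    · have h1 := ih (i := i + 1) (by lia) hxa
      have h2 := discreteDeriv_taylorProd_congr ha N (i := i) (l := 0) hxa
      have e1 : discreteDeriv (fun m => (a ^ m)⁻¹ * x * a ^ m) =
          fun m => (a ^ m)⁻¹ * cmt x a * a ^ m := by
        funext m
        simp only [discreteDeriv, cmt, pow_succ']
        group
      have e2 : discreteDeriv (taylorProd a (N + 1) x 0) =
          discreteDeriv (taylorProd a N (cmt x a) (0 + 1)) := by
        funext m
        simp only [discreteDeriv, taylorProd, Pi.mul_apply, Nat.choose_zero_right]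
        group
      rw [e1, e2]
      convert mul_mem h1 (inv_mem h2) using 1
      group

theorem cmt_pow_congr_taylorProd (ha : a ∈ H.sub 1 0) {n : ℕ}
    (hH : ∀ i, n < i → H.sub i 1 ≤ H.sub i 2) {b : G} (hc : cmt a b ∈ H.sub 1 1) :
    (fun m => cmt (a ^ m) b) * (taylorProd a n (cmt a b) 1)⁻¹ ∈ H.polySeq 0 2 := by
  set c := cmt a b with hcdef
  set f : ℕ → G := fun m => cmt (a ^ m) b with hf
  have hf0 : f ∈ H.polySeq 0 0 := by
    have hac : a * c ∈ H.sub 1 0 := mul_mem ha (H.anti le_rfl (Nat.zero_le _) hc)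
    convert mul_mem (inv_mem (pow_mem_polySeq ha)) (pow_mem_polySeq hac) using 1
    funext m
    have : a * c = b⁻¹ * a * b⁻¹⁻¹ := by simp only [hcdef, cmt]; group
    simp only [hf, Pi.mul_apply, Pi.inv_apply, this, conj_pow, cmt]
    group
  set g : ℕ → G := fun m => (a ^ m)⁻¹ * c * a ^ m with hg
  have hgmem : g ∈ H.polySeq 1 1 :=
    conj_mem_polySeq (const_mem_polySeq hc) (pow_mem_polySeq ha)
  have hdf : discreteDeriv f = f⁻¹ * g * f := by
    funext m
    simp only [discreteDeriv, hf, hg, hcdef, Pi.mul_apply, Pi.inv_apply, cmt, pow_succ']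
    group
  have hf1 : f ∈ H.polySeq 0 1 := by
    refine mem_polySeq_of_discreteDeriv (by simp [hf, cmt]) ?_
    rw [hdf]
    exact conj_mem_polySeq hgmem hf0
  refine mul_inv_mem_polySeq_of_discreteDeriv ?_ ?_ ?_
  · exact polySeq_anti le_rfl (Nat.zero_le _) (taylorProd_mem_polySeq ha n (i := 0) hc)
  · rw [taylorProd_apply_of_lt a n _ Nat.zero_lt_one]
    simp [hf, cmt]
  · have h1 : g * (taylorProd a n c 0)⁻¹ ∈ H.polySeq 1 2 :=
      conj_pow_congr_taylorProd ha hH n (by lia) hc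
    have h2 := discreteDeriv_taylorProd_congr ha n (i := 0) (l := 0) (x := c) hc
    have h3 := conj_mem_polySeq (cmt_mem_polySeq hgmem hf1)
      (polySeq_anti (Nat.zero_le _) (Nat.zero_le _) (inv_mem hgmem))
    have h4 := mul_mem (mul_mem h3 h1) (inv_mem h2)
    convert h4 using 1
    rw [hdf]
    simp only [cmt]
    group

end BiFiltration

end PolynomialSequences

namespace FormalCommutator

variable {G : Type*} [Group G]

theorem eval_mem_commutator {u v : G} (hv : v ∈ commutator G) (w : FormalCommutator)
    (hw : 1 ≤ w.weightSnd) : eval u v w ∈ commutator G := by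
  cases w with
  | fst => simp [weightSnd] at hw
  | snd => exact hv
  | comm c d => exact cmt_mem_commutator _ _

theorem eval_mem_lowerCentralSeries (u v : G) (k : ℕ) (w : FormalCommutator)
    (hw : 2 ^ k ≤ w.weightFst + w.weightSnd) :
    eval u v w ∈ (⊤ : Subgroup G).lowerCentralSeries k := by
  induction k generalizing w with
  | zero => exact Subgroup.mem_top _
  | succ k ih =>
    have h1 : 1 ≤ 2 ^ k := Nat.one_le_two_pow
    rw [pow_succ] at hw
    cases w with
    | fst => simp only [weightFst, weightSnd] at hw; lia
    | snd => simp only [weightFst, weightSnd] at hw; lia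
    | comm c d =>
      simp only [weightFst, weightSnd] at hw
      have key (x y : G) (hx : x ∈ (⊤ : Subgroup G).lowerCentralSeries k) :
          cmt x y ∈ (⊤ : Subgroup G).lowerCentralSeries (k + 1) := by
        have := Subgroup.commutator_mem_commutator (inv_mem hx) (Subgroup.mem_top y⁻¹)
        rwa [commutatorElement_def, inv_inv, inv_inv] at this
      rcases le_total (2 ^ k) (c.weightFst + c.weightSnd) with hc | hc
      · exact key _ _ (ih c hc)
      · have := inv_mem (key (eval u v d) (eval u v c) (ih d (by lia)))
        convert this using 1
        simp only [eval, cmt]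
        group

/-- The subgroup generated by the values of the formal commutators of total weight at least `i`
and of weight at least `j` in the second letter. -/
def weightSubgroup (u v : G) (i j : ℕ) : Subgroup G :=
  Subgroup.closure {g | ∃ w : FormalCommutator, i ≤ w.weightFst + w.weightSnd ∧
    j ≤ w.weightSnd ∧ eval u v w = g}

theorem weightSubgroup_anti (u v : G) {i i' j j' : ℕ} (hi : i ≤ i') (hj : j ≤ j') :
    weightSubgroup u v i' j' ≤ weightSubgroup u v i j :=
  Subgroup.closure_mono fun _ ⟨w, h1, h2, h3⟩ => ⟨w, hi.trans h1, hj.trans h2, h3⟩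

theorem eval_mem_weightSubgroup (u v : G) {i j : ℕ} (w : FormalCommutator)
    (hi : i ≤ w.weightFst + w.weightSnd) (hj : j ≤ w.weightSnd) :
    eval u v w ∈ weightSubgroup u v i j :=
  Subgroup.subset_closure ⟨w, hi, hj, rfl⟩

theorem weightSubgroup_le_normalizer [Finite G] (u v : G) (i j k l : ℕ) :
    weightSubgroup u v k l ≤
      Subgroup.normalizer (weightSubgroup u v i j : Set G) := by
  refine (Subgroup.closure_le _).2 ?_
  rintro _ ⟨w, -, -, rfl⟩
  rw [SetLike.mem_coe, ← inv_mem_iff]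
  refine Subgroup.mem_normalizer_fintype fun x hx => ?_
  rw [SetLike.mem_coe] at hx ⊢
  rw [inv_inv]
  induction hx using Subgroup.closure_induction with
  | mem x hx =>
    obtain ⟨w', h1, h2, rfl⟩ := hx
    rw [conj_eq_mul_cmt]
    exact mul_mem (eval_mem_weightSubgroup u v w' h1 h2)
      (eval_mem_weightSubgroup u v (w'.comm w) (by simp only [weightFst, weightSnd]; lia)
        (by simp only [weightSnd]; lia))
  | one => simp
  | mul x y _ _ ihx ihy => simpa [mul_assoc] using mul_mem ihx ihy
  | inv x _ ihx => simpa [mul_assoc] using inv_mem ihx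

/-- The bifiltration by total weight and weight in the second letter. -/
def weightFiltration [Finite G] (u v : G) : BiFiltration G where
  sub := weightSubgroup u v
  anti := weightSubgroup_anti u v
  cmt_mem hx hy := by
    refine cmt_mem_of_closure (weightSubgroup_le_normalizer u v _ _ _ _)
      (weightSubgroup_le_normalizer u v _ _ _ _) ?_ hx hy
    rintro _ ⟨w, h1, h2, rfl⟩ _ ⟨w', h3, h4, rfl⟩
    exact eval_mem_weightSubgroup u v (w.comm w') (by simp only [weightFst, weightSnd]; lia)
      (by simp only [weightSnd]; lia)

theorem weightSubgroup_eq_bot [Group.IsNilpotent G] (u v : G) :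
    ∃ M, ∀ i j, M < i → weightSubgroup u v i j = ⊥ := by
  obtain ⟨n, hn⟩ := Subgroup.nilpotent_iff_lowerCentralSeries.1 ‹Group.IsNilpotent G›
  refine ⟨2 ^ n, fun i j hi => (Subgroup.closure_eq_bot_iff).2 ?_⟩
  rintro _ ⟨w, hw, -, rfl⟩
  rw [Set.mem_singleton_iff, ← Subgroup.mem_bot, ← hn]
  exact eval_mem_lowerCentralSeries u v n w (by lia)

end FormalCommutator

/-- Lemma 2.2 (second congruence):  in a finite `p`-group, `p` odd, generated by `a, b`, whose
derived subgroup has exponent dividing `p`, one has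
`[a^{p^r}, b] ≡ [a, b, a, …, a] (p^r − 1 copies of a after b)` modulo the normal closure
`K(a,[a,b])` of the values of all formal commutators in the letters `a` and `c = [a,b]` of
total weight at least `p^r` having weight at least `2` in the letter `c`. -/
theorem pow_commutator_congruence_mod_K (p : ℕ) (hp : p.Prime) (hodd : Odd p) (G : Type*)
    [Group G] [Finite G] (hpG : IsPGroup p G) (a b : G)
    (hgen : Subgroup.closure ({a, b} : Set G) = ⊤)
    (hexp : ∀ g ∈ commutator G, g ^ p = 1) (r : ℕ) :
    cmt (a ^ p ^ r) b * (iteratedCmt (cmt a b) a (p ^ r - 1))⁻¹ ∈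
      Subgroup.normalClosure
        {g : G | ∃ c : FormalCommutator,
          p ^ r ≤ c.weightFst + c.weightSnd ∧ 2 ≤ c.weightSnd ∧
            FormalCommutator.eval a (cmt a b) c = g} := by
  have : Fact p.Prime := ⟨hp⟩
  have : Group.IsNilpotent G := hpG.isNilpotent
  have hc : cmt a b ∈ commutator G := cmt_mem_commutator a b
  obtain ⟨M, hM⟩ := FormalCommutator.weightSubgroup_eq_bot a (cmt a b)
  have hpos : 1 ≤ p ^ r := Nat.one_le_pow _ _ hp.pos
  have hq := BiFiltration.cmt_pow_congr_taylorProd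
    (H := FormalCommutator.weightFiltration a (cmt a b)) (a := a) (b := b)
    (FormalCommutator.eval_mem_weightSubgroup a (cmt a b) .fst le_rfl le_rfl)
    (n := M + p ^ r) (fun i hi => (hM i 1 (by lia)).le.trans bot_le)
    (FormalCommutator.eval_mem_weightSubgroup a (cmt a b) .snd le_rfl le_rfl)
  have h := BiFiltration.apply_prime_pow_mem (r := r) hp hq
    (by simp [taylorProd_apply_of_lt, cmt]) (fun k _ _ g hg => hexp g (by
      refine (Subgroup.closure_le _).2 ?_ hg
      rintro _ ⟨w, -, hw, rfl⟩
      exact FormalCommutator.eval_mem_commutator hc w (by lia)))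
  rw [Pi.mul_apply, Pi.inv_apply,
    taylorProd_apply_prime_pow hp r hexp a (p ^ r - 1) _ 1 _ hc (by lia) (by lia) (by lia)] at h
  exact Subgroup.closure_le_normalClosure h
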